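/- Let γ be an even positive integer, ε > 0 and d ≥ 1. For θ ∈ ℝ^d, let (y_{i,m})_{1≤i≤d, 1≤m≤γ} be mutually independent real random variables with y_{i,m} distributed as N(θ_i, γ ε²), let Ñ_γ = Σ_{i=1}^d ∏_{m=1}^γ y_{i,m} and ñ_γ = |Ñ_γ|^{1/γ}. Then there exists a constant C > 0 depending only on γ such that sup over all θ ∈ ℝ^d of E[(ñ_γ − ‖θ‖_γ)²] is at most C ε² d^{1/γ}. -/

import Mathlib

open MeasureTheory ProbabilityTheory Real

lemma sub_mul_pow_le_abs_pow_succ_sub_pow_succ {a b : ℝ} (ha : 0 ≤ a) (hb : 0 ≤ b) (k : ℕ) :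
    |a - b| * b ^ k ≤ |a ^ (k + 1) - b ^ (k + 1)| := by
  rcases le_total b a with h | h
  · have h1 : b ^ k ≤ a ^ k := pow_le_pow_left₀ hb h k
    rw [abs_of_nonneg (sub_nonneg.2 h)]
    refine le_trans ?_ (le_abs_self _)
    rw [pow_succ, pow_succ]
    nlinarith [mul_le_mul_of_nonneg_left h1 ha]
  · have h1 : a ^ k ≤ b ^ k := pow_le_pow_left₀ ha h k
    rw [abs_of_nonpos (sub_nonpos.2 h)]
    refine le_trans ?_ (neg_le_abs _)
    rw [pow_succ, pow_succ]
    nlinarith [mul_le_mul_of_nonneg_left h1 ha]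

lemma abs_sub_pow_le_abs_pow_sub_pow {a b : ℝ} (ha : 0 ≤ a) (hb : 0 ≤ b) {n : ℕ} (hn : n ≠ 0) :
    |a - b| ^ n ≤ |a ^ n - b ^ n| := by
  rcases le_total b a with h | h
  · have h1 := pow_add_pow_le hb (sub_nonneg.2 h) hn
    rw [add_sub_cancel] at h1
    rw [abs_of_nonneg (sub_nonneg.2 h)]
    exact le_trans (by linarith) (le_abs_self _)
  · have h1 := pow_add_pow_le ha (sub_nonneg.2 h) hn
    rw [add_sub_cancel] at h1
    rw [abs_sub_comm, abs_of_nonneg (sub_nonneg.2 h)]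
    exact le_trans (by linarith) (neg_le_abs _)

/-- A truncated inverse-Lipschitz bound for `x ↦ x ^ (k + 1)` on the nonnegative reals. -/
lemma sq_sub_mul_max_pow_le {a b t : ℝ} (ha : 0 ≤ a) (hb : 0 ≤ b) (ht : 0 ≤ t) (k : ℕ) :
    (a - b) ^ 2 * (max b t ^ k) ^ 2
      ≤ t ^ 2 * (max b t ^ k) ^ 2 + (a ^ (k + 1) - b ^ (k + 1)) ^ 2 := by
  rcases le_total |a - b| t with h | h
  · have h1 : (a - b) ^ 2 ≤ t ^ 2 := sq_le_sq' (by linarith [neg_abs_le (a - b)])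
      (by linarith [le_abs_self (a - b)])
    nlinarith [mul_le_mul_of_nonneg_right h1 (sq_nonneg (max b t ^ k)),
      sq_nonneg (a ^ (k + 1) - b ^ (k + 1))]
  · have h1 : |a - b| * max b t ^ k ≤ |a ^ (k + 1) - b ^ (k + 1)| := by
      rcases le_total t b with h2 | h2
      · rw [max_eq_left h2]
        exact sub_mul_pow_le_abs_pow_succ_sub_pow_succ ha hb k
      · rw [max_eq_right h2]
        refine le_trans ?_ (abs_sub_pow_le_abs_pow_sub_pow ha hb k.succ_ne_zero)
        rw [pow_succ']
        gcongr
    have h2 := pow_le_pow_left₀ (by positivity) h1 2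
    rw [mul_pow, sq_abs, sq_abs] at h2
    nlinarith [sq_nonneg (t * max b t ^ k)]

lemma add_pow_succ_sub_pow_succ_le {a v : ℝ} (ha : 0 ≤ a) (hv : 0 ≤ v) (k : ℕ) :
    (a + v) ^ (k + 1) - a ^ (k + 1) ≤ (k + 1) * 2 ^ (k - 1) * (v * (a ^ k + v ^ k)) := by
  have h := abs_pow_sub_pow_le (a + v) a (k + 1)
  rw [add_sub_cancel_left, abs_of_nonneg hv, abs_of_nonneg ha, abs_of_nonneg (add_nonneg ha hv),
    max_eq_left (by linarith), Nat.add_sub_cancel] at h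
  push_cast at h
  calc (a + v) ^ (k + 1) - a ^ (k + 1) ≤ v * (k + 1) * (a + v) ^ k := (le_abs_self _).trans h
    _ ≤ v * (k + 1) * (2 ^ (k - 1) * (a ^ k + v ^ k)) := by
      gcongr
      exact add_pow_le ha hv k
    _ = _ := by ring

lemma sum_sq_pow_le_of_sum_pow_eq {ι : Type*} [Fintype ι] {x : ι → ℝ} {s : ℝ} (hs : 0 ≤ s)
    {k : ℕ} (hk : 1 ≤ k) (h : ∑ i, |x i| ^ (k + 1) = s ^ (k + 1)) :
    ∑ i, (x i ^ 2) ^ k ≤ (s ^ k) ^ 2 := by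
  obtain ⟨l, rfl⟩ := Nat.exists_eq_add_of_le' hk
  have hle : ∀ i, |x i| ≤ s := fun i ↦ by
    refine le_of_pow_le_pow_left₀ (Nat.succ_ne_zero (l + 1)) hs ?_
    rw [Nat.succ_eq_add_one, ← h]
    exact Finset.single_le_sum (f := fun i ↦ |x i| ^ (l + 1 + 1)) (fun j _ ↦ by positivity)
      (Finset.mem_univ i)
  calc ∑ i, (x i ^ 2) ^ (l + 1) = ∑ i, |x i| ^ (l + 1 + 1) * |x i| ^ l := by
        refine Finset.sum_congr rfl fun i _ ↦ ?_
        rw [← sq_abs]; ring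
    _ ≤ ∑ i, |x i| ^ (l + 1 + 1) * s ^ l := by
        gcongr with i
        exact hle i
    _ = (s ^ (l + 1)) ^ 2 := by
        rw [← Finset.sum_mul, h]; ring

section RowProducts

variable {ι κ : Type*} [Fintype ι] [Fintype κ]

lemma prod_row_eq_prod_ite [DecidableEq ι] (f : ι × κ → ℝ) (i : ι) :
    ∏ m, f (i, m) = ∏ p : ι × κ, if p.1 = i then f p else 1 := by
  rw [Fintype.prod_prod_type, Finset.prod_eq_single i]
  · simp
  · intro j _ hj
    simp [hj]
  · simp

variable (μ : ι → Measure ℝ) [∀ i, IsProbabilityMeasure (μ i)]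

lemma integral_prod_row (f : ℝ → ℝ) (i : ι) :
    ∫ y : ι × κ → ℝ, ∏ m, f (y (i, m)) ∂(Measure.pi fun p : ι × κ ↦ μ p.1)
      = (∫ x, f x ∂μ i) ^ Fintype.card κ := by
  classical
  simp_rw [fun y : ι × κ → ℝ ↦ prod_row_eq_prod_ite (fun p ↦ f (y p)) i]
  rw [integral_fintype_prod_eq_prod (fun (p : ι × κ) x ↦ if p.1 = i then f x else 1),
    Fintype.prod_prod_type, Finset.prod_eq_single i]
  · simp
  · intro j _ hj
    simp [hj]
  · simp

lemma integrable_prod_row {f : ℝ → ℝ} (i : ι) (hf : Integrable f (μ i)) :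
    Integrable (fun y : ι × κ → ℝ ↦ ∏ m, f (y (i, m))) (Measure.pi fun p : ι × κ ↦ μ p.1) := by
  classical
  simp_rw [fun y : ι × κ → ℝ ↦ prod_row_eq_prod_ite (fun p ↦ f (y p)) i]
  refine Integrable.fintype_prod (f := fun (p : ι × κ) x ↦ if p.1 = i then f x else 1) fun p ↦ ?_
  by_cases h : p.1 = i
  · simpa [h] using hf
  · simp [h]

lemma memLp_two_prod_row (i : ι) (h : MemLp id 2 (μ i)) :
    MemLp (fun y : ι × κ → ℝ ↦ ∏ m, y (i, m)) 2 (Measure.pi fun p : ι × κ ↦ μ p.1) := by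
  rw [memLp_two_iff_integrable_sq
    (Finset.measurable_prod _ fun m _ ↦ measurable_pi_apply (i, m)).aestronglyMeasurable]
  simp_rw [← Finset.prod_pow]
  exact integrable_prod_row μ i h.integrable_sq

lemma variance_prod_row (i : ι) (h : MemLp id 2 (μ i)) :
    Var[fun y : ι × κ → ℝ ↦ ∏ m, y (i, m); Measure.pi fun p : ι × κ ↦ μ p.1]
      = ((∫ x, x ∂μ i) ^ 2 + Var[id; μ i]) ^ Fintype.card κ
        - ((∫ x, x ∂μ i) ^ 2) ^ Fintype.card κ := by
  rw [variance_eq_sub (memLp_two_prod_row μ i h), variance_eq_sub h]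
  simp only [Pi.pow_apply, id, ← Finset.prod_pow]
  rw [integral_prod_row μ (fun x ↦ x ^ 2), integral_prod_row μ (fun x ↦ x)]
  ring

lemma indepFun_prod_row {i j : ι} (hij : i ≠ j) :
    IndepFun (fun y : ι × κ → ℝ ↦ ∏ m, y (i, m)) (fun y ↦ ∏ m, y (j, m))
      (Measure.pi fun p : ι × κ ↦ μ p.1) := by
  classical
  have h : iIndepFun (fun (p : ι × κ) (y : ι × κ → ℝ) ↦ y p)
      (Measure.pi fun p : ι × κ ↦ μ p.1) :=
    iIndepFun_pi (X := fun _ ↦ id) fun _ ↦ aemeasurable_id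
  let row (i : ι) : Finset (ι × κ) := Finset.univ.filter fun p ↦ p.1 = i
  have hrow (i : ι) (m : κ) : (i, m) ∈ row i := by simp [row]
  have hdisj : Disjoint (row i) (row j) :=
    Finset.disjoint_filter.2 fun p _ hi hj ↦ hij (hi.symm.trans hj)
  exact (h.indepFun_finset (row i) (row j) hdisj fun p ↦ measurable_pi_apply p).comp
    (φ := fun z ↦ ∏ m, z ⟨(i, m), hrow i m⟩) (ψ := fun z ↦ ∏ m, z ⟨(j, m), hrow j m⟩)
    (by fun_prop) (by fun_prop)

lemma variance_sum_prod_row (h : ∀ i, MemLp id 2 (μ i)) :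
    Var[fun y : ι × κ → ℝ ↦ ∑ i, ∏ m, y (i, m); Measure.pi fun p : ι × κ ↦ μ p.1]
      = ∑ i, (((∫ x, x ∂μ i) ^ 2 + Var[id; μ i]) ^ Fintype.card κ
        - ((∫ x, x ∂μ i) ^ 2) ^ Fintype.card κ) := by
  simp_rw [← fun i ↦ variance_prod_row (κ := κ) μ i (h i)]
  rw [← IndepFun.variance_sum (fun i _ ↦ memLp_two_prod_row μ i (h i))
    fun i _ j _ hij ↦ indepFun_prod_row μ hij]
  congr 1
  ext y
  simp

lemma integral_sum_prod_row (h : ∀ i, Integrable id (μ i)) :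
    ∫ y : ι × κ → ℝ, ∑ i, ∏ m, y (i, m) ∂(Measure.pi fun p : ι × κ ↦ μ p.1)
      = ∑ i, (∫ x, x ∂μ i) ^ Fintype.card κ := by
  rw [integral_finsetSum _ fun i _ ↦ integrable_prod_row (f := fun x ↦ x) μ i (h i)]
  exact Finset.sum_congr rfl fun i _ ↦ integral_prod_row μ (fun x ↦ x) i

end RowProducts

lemma memLp_id_two_gaussianReal (m : ℝ) (v : NNReal) : MemLp id 2 (gaussianReal m v) :=
  mod_cast memLp_id_gaussianReal 2

/-- Theorem 3(ii) (upper bound for estimating the `ℓ_γ`-norm, `γ` an even positive integer).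
For an even positive integer `γ` there is a constant `C > 0` depending only on `γ` such
that for every dimension `d ≥ 1`, noise level `ε > 0` and every `θ ∈ ℝ^d`, the estimator
`ñ_γ = |Ñ_γ|^{1/γ}` with `Ñ_γ = ∑_i ∏_m y_{i,m}` built from mutually independent
`y_{i,m} ~ N(θ_i, γ ε²)` satisfies `E[(ñ_γ − ‖θ‖_γ)²] ≤ C ε² d^{1/γ}`. -/
theorem even_gamma_upper_bound_norm (γ : ℕ) (hγeven : Even γ) (hγpos : 0 < γ) :
    ∃ C : ℝ, 0 < C ∧
      ∀ d : ℕ, 1 ≤ d → ∀ ε : ℝ, 0 < ε → ∀ θ : Fin d → ℝ,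
        ∫ y : Fin d × Fin γ → ℝ,
            (|∑ i, ∏ m, y (i, m)| ^ ((1 : ℝ) / γ)
              - (∑ i, |θ i| ^ (γ : ℕ)) ^ ((1 : ℝ) / γ)) ^ 2
            ∂(Measure.pi fun p : Fin d × Fin γ =>
                gaussianReal (θ p.1) ((γ : ℝ) * ε ^ 2).toNNReal)
          ≤ C * ε ^ 2 * (d : ℝ) ^ ((1 : ℝ) / γ) := by
  obtain ⟨k, rfl⟩ : ∃ k, γ = k + 1 := ⟨γ - 1, by omega⟩
  have hk : 1 ≤ k := by
    rcases k with _ | k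
    · simp at hγeven
    · omega
  set K : ℝ := (k + 1) * 2 ^ (k - 1) with hK
  have hK0 : 0 < K := by positivity
  refine ⟨(1 + 2 * K) * (k + 1), by positivity, fun d hd ε hε θ ↦ ?_⟩
  have root_pow (x : ℝ) (hx : 0 ≤ x) : (x ^ ((1 : ℝ) / (k + 1 : ℕ))) ^ (k + 1) = x := by
    rw [one_div]
    exact rpow_inv_natCast_pow hx k.succ_ne_zero
  set v : ℝ := ((k + 1 : ℕ) : ℝ) * ε ^ 2 with hv
  have hv0 : 0 < v := by positivity
  set D : ℝ := (d : ℝ) ^ ((1 : ℝ) / (k + 1 : ℕ)) with hD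
  have hDpow : D ^ (k + 1) = d := root_pow _ (by positivity)
  have hd1 : (1 : ℝ) ≤ d := by exact_mod_cast hd
  have hD1 : 1 ≤ D := one_le_rpow hd1 (by positivity)
  set S : ℝ := ∑ i, |θ i| ^ (k + 1) with hS
  have hS0 : 0 ≤ S := by positivity
  set s : ℝ := S ^ ((1 : ℝ) / (k + 1 : ℕ)) with hs
  have hs0 : 0 ≤ s := by positivity
  have hspow : s ^ (k + 1) = S := root_pow _ hS0
  set t : ℝ := √(v * D) with ht
  have ht0 : 0 < t := by positivity
  have htsq : t ^ 2 = v * D := sq_sqrt (by positivity)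
  set M : ℝ := max s t with hM
  have hMpos : 0 < M := ht0.trans_le (le_max_right _ _)
  set P : Measure (Fin d × Fin (k + 1) → ℝ) :=
    Measure.pi fun p ↦ gaussianReal (θ p.1) v.toNNReal with hP
  set N : (Fin d × Fin (k + 1) → ℝ) → ℝ := fun y ↦ ∑ i, ∏ m, y (i, m) with hN
  have hNmem : MemLp N 2 P :=
    memLp_finsetSum _ fun i _ ↦ memLp_two_prod_row (fun i ↦ gaussianReal (θ i) v.toNNReal) i
      (memLp_id_two_gaussianReal _ _)
  have hNmean : ∫ y, N y ∂P = S := by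
    have h := integral_sum_prod_row (κ := Fin (k + 1)) (fun i ↦ gaussianReal (θ i) v.toNNReal)
      fun i ↦ (memLp_id_two_gaussianReal _ _).integrable one_le_two
    simp only [integral_id_gaussianReal, Fintype.card_fin] at h
    rw [hS, hN, hP, h]
    exact Finset.sum_congr rfl fun i _ ↦ (hγeven.pow_abs _).symm
  have hNvar : ∫ y, (N y - S) ^ 2 ∂P ≤ 2 * K * t ^ 2 * (M ^ k) ^ 2 := by
    have h := variance_sum_prod_row (κ := Fin (k + 1)) (fun i ↦ gaussianReal (θ i) v.toNNReal)
      fun i ↦ memLp_id_two_gaussianReal _ _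
    simp only [integral_id_gaussianReal, variance_id_gaussianReal, Fintype.card_fin,
      Real.coe_toNNReal v hv0.le] at h
    rw [variance_eq_integral hNmem.aemeasurable, hNmean] at h
    rw [h]
    have hvt : v ≤ t ^ 2 := by rw [htsq]; nlinarith
    have hdv : d * (v * v ^ k) = t ^ 2 * (t ^ k) ^ 2 := by
      rw [← hDpow, pow_right_comm, htsq]; ring
    calc ∑ i, ((θ i ^ 2 + v) ^ (k + 1) - (θ i ^ 2) ^ (k + 1))
        ≤ ∑ i, K * (v * ((θ i ^ 2) ^ k + v ^ k)) :=
          Finset.sum_le_sum fun i _ ↦ add_pow_succ_sub_pow_succ_le (sq_nonneg _) hv0.le k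
      _ = K * (v * ∑ i, (θ i ^ 2) ^ k + d * (v * v ^ k)) := by
          rw [← Finset.mul_sum, ← Finset.mul_sum, Finset.sum_add_distrib,
            Finset.sum_const, Finset.card_univ, Fintype.card_fin, nsmul_eq_mul]
          ring
      _ ≤ K * (t ^ 2 * (M ^ k) ^ 2 + t ^ 2 * (M ^ k) ^ 2) := by
          rw [hdv]
          gcongr
          · refine (sum_sq_pow_le_of_sum_pow_eq hs0 hk hspow.symm).trans ?_
            gcongr
            exact le_max_left _ _
          · exact le_max_right _ _
      _ = 2 * K * t ^ 2 * (M ^ k) ^ 2 := by ring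
  have hint : Integrable (fun y ↦ (N y - S) ^ 2) P :=
    (hNmem.sub (memLp_const S)).integrable_sq
  calc ∫ y, (|N y| ^ ((1 : ℝ) / (k + 1 : ℕ)) - s) ^ 2 ∂P
      ≤ ∫ y, (t ^ 2 + (N y - S) ^ 2 / (M ^ k) ^ 2) ∂P := by
        refine integral_mono_of_nonneg (ae_of_all _ fun y ↦ sq_nonneg _)
          ((integrable_const _).add (hint.div_const _)) (ae_of_all _ fun y ↦ ?_)
        have h := sq_sub_mul_max_pow_le
          (rpow_nonneg (abs_nonneg (N y)) ((1 : ℝ) / (k + 1 : ℕ))) hs0 ht0.le k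
        rw [root_pow _ (abs_nonneg _), hspow] at h
        have h2 : (|N y| - S) ^ 2 ≤ (N y - S) ^ 2 := by
          nlinarith [mul_le_mul_of_nonneg_right (le_abs_self (N y)) hS0, sq_abs (N y)]
        have hpos : 0 < (M ^ k) ^ 2 := by positivity
        dsimp only
        rw [← mul_le_mul_iff_left₀ hpos, add_mul, div_mul_cancel₀ _ hpos.ne']
        exact h.trans (by gcongr)
    _ = t ^ 2 + (∫ y, (N y - S) ^ 2 ∂P) / (M ^ k) ^ 2 := by
        rw [integral_add (integrable_const _) (hint.div_const _), integral_div]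
        simp
    _ ≤ t ^ 2 + 2 * K * t ^ 2 := by
        gcongr
        exact (div_le_iff₀ (by positivity)).2 hNvar
    _ = (1 + 2 * K) * (k + 1) * ε ^ 2 * D := by
        rw [htsq, hv]; push_cast; ring
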